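/- For every K ∈ ℕ with K ≥ 1 there is a constant c = c(K) > 0 with the following property. Let φ : ℝ → ℝ be a smooth function periodic with period L > 0, let l ∈ ℝ with l ≥ 2, let i ∈ ℕ with 0 ≤ i < K, and set α = (i + 1/2 − 1/l)/K. Then L^{i+1−1/l} · (∫₀^L |φ^{(i)}(x)|^l dx)^{1/l} ≤ c · (L·∫₀^L φ(x)² dx)^{(1−α)/2} · ‖φ‖_{K,2}^{α}. -/

import Mathlib

open MeasureTheory intervalIntegral

/-- The scale-invariant Sobolev-type norm
`‖φ‖_{K,2} = Σ_{j=0}^{K} L^{j+1/2} (∫₀^L (φ^{(j)})²)^{1/2}`. -/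
noncomputable def sobNorm (K : ℕ) (L : ℝ) (φ : ℝ → ℝ) : ℝ :=
  ∑ j ∈ Finset.range (K + 1),
    L ^ ((j : ℝ) + 1 / 2) * (∫ x in (0:ℝ)..L, (iteratedDeriv j φ x) ^ 2) ^ ((1 : ℝ) / 2)

/-- The scale-invariant `L²` seminorm `L^{j+1/2} ‖φ^{(j)}‖₂` of the `j`-th derivative. -/
noncomputable def scaledDerivNorm (L : ℝ) (φ : ℝ → ℝ) (j : ℕ) : ℝ :=
  L ^ ((j : ℝ) + 1 / 2) * √(∫ x in (0:ℝ)..L, (iteratedDeriv j φ x) ^ 2)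

/-- The geometric interpolation `t^{1-p} S^p` between `t` and `S`. -/
noncomputable def geomInterp (t S p : ℝ) : ℝ := t ^ (1 - p) * S ^ p

section Interpolation

variable {t S p q θ : ℝ}

lemma geomInterp_nonneg (ht : 0 ≤ t) (hS : 0 ≤ S) : 0 ≤ geomInterp t S p := by
  unfold geomInterp
  positivity

lemma geomInterp_mono (ht : 0 ≤ t) (hS : t ≤ S) (hp : 0 ≤ p) (hpq : p ≤ q) (hq : q ≤ 1) :
    geomInterp t S p ≤ geomInterp t S q := by
  have hS0 := ht.trans hS
  unfold geomInterp
  calc t ^ (1 - p) * S ^ p = t ^ (1 - q) * t ^ (q - p) * S ^ p := by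
        rw [← Real.rpow_add_of_nonneg ht (by linarith) (by linarith)]; ring_nf
    _ ≤ t ^ (1 - q) * S ^ (q - p) * S ^ p := by
        gcongr
    _ = t ^ (1 - q) * S ^ q := by
        rw [mul_assoc, ← Real.rpow_add_of_nonneg hS0 (by linarith) hp]; ring_nf

lemma geomInterp_rpow_mul_rpow (ht : 0 ≤ t) (hS : 0 ≤ S) (hp : 0 ≤ p) (hp1 : p ≤ 1)
    (hq : 0 ≤ q) (hq1 : q ≤ 1) (hθ : 0 ≤ θ) (hθ1 : θ ≤ 1) :
    geomInterp t S p ^ θ * geomInterp t S q ^ (1 - θ) =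
      geomInterp t S (θ * p + (1 - θ) * q) := by
  have h1 : 0 ≤ 1 - p := by linarith
  have h2 : 0 ≤ 1 - q := by linarith
  have h3 : 0 ≤ 1 - θ := by linarith
  unfold geomInterp
  rw [Real.mul_rpow (by positivity) (by positivity), Real.mul_rpow (by positivity) (by positivity),
    ← Real.rpow_mul ht, ← Real.rpow_mul ht, ← Real.rpow_mul hS, ← Real.rpow_mul hS,
    mul_mul_mul_comm, ← Real.rpow_add_of_nonneg ht (by positivity) (by positivity),
    ← Real.rpow_add_of_nonneg hS (by positivity) (by positivity)]
  ring_nf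

lemma geomInterp_mul (ht : 0 ≤ t) (hS : 0 ≤ S) (hp : 0 ≤ p) (hp1 : p ≤ 1)
    (hq : 0 ≤ q) (hq1 : q ≤ 1) :
    geomInterp t S p * geomInterp t S q = geomInterp t S ((p + q) / 2) ^ 2 := by
  have h := geomInterp_rpow_mul_rpow (θ := 1 / 2) ht hS hp hp1 hq hq1 (by norm_num) (by norm_num)
  rw [show (p + q) / 2 = 1 / 2 * p + (1 - 1 / 2) * q by ring, ← h,
    show (1 : ℝ) - 1 / 2 = 1 / 2 by norm_num, ← Real.sqrt_eq_rpow, ← Real.sqrt_eq_rpow, mul_pow,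
    Real.sq_sqrt (geomInterp_nonneg ht hS), Real.sq_sqrt (geomInterp_nonneg ht hS)]

/-- If `a`, `b` are controlled by consecutive interpolants and `M² ≤ a² + 2ab`, then the
products `M^θ a^{1-θ}` are controlled by the corresponding interpolant. -/
lemma rpow_mul_rpow_le_geomInterp {a b M : ℝ} (ht : 0 ≤ t) (hS : t ≤ S) (hp : 0 ≤ p)
    (hq : 0 ≤ q) (hpq : p + q ≤ 1) (hθ : 0 ≤ θ) (hθ1 : θ ≤ 1) (ha : 0 ≤ a) (hM : 0 ≤ M)
    (hap : a ≤ geomInterp t S p) (hbq : b ≤ geomInterp t S (p + q))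
    (hMab : M ^ 2 ≤ a ^ 2 + 2 * (a * b)) :
    M ^ θ * a ^ (1 - θ) ≤ 2 * geomInterp t S (p + θ * q / 2) := by
  have hS0 := ht.trans hS
  have hp1 : p ≤ 1 := by linarith
  have hG := geomInterp_nonneg (p := p + q / 2) ht hS0
  have hH := geomInterp_nonneg (p := p) ht hS0
  have hM2 : M ≤ 2 * geomInterp t S (p + q / 2) := by
    have hmul := geomInterp_mul ht hS0 hp hp1 (add_nonneg hp hq) hpq
    rw [show (p + (p + q)) / 2 = p + q / 2 by ring] at hmul
    have hmono := geomInterp_mono ht hS hp (by linarith : p ≤ p + q) hpq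
    have h1 : a * a ≤ geomInterp t S p * geomInterp t S (p + q) :=
      mul_le_mul hap (hap.trans hmono) ha hH
    have h2 : a * b ≤ geomInterp t S p * geomInterp t S (p + q) :=
      (mul_le_mul_of_nonneg_left hbq ha).trans
        (mul_le_mul_of_nonneg_right hap (geomInterp_nonneg ht hS0))
    refine le_of_sq_le_sq ?_ (by positivity)
    nlinarith [sq_nonneg (geomInterp t S (p + q / 2))]
  calc M ^ θ * a ^ (1 - θ)
      ≤ (2 * geomInterp t S (p + q / 2)) ^ θ * geomInterp t S p ^ (1 - θ) := by
        gcongr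
    _ = 2 ^ θ * geomInterp t S (p + θ * q / 2) := by
        rw [Real.mul_rpow (by norm_num) hG, mul_assoc,
          geomInterp_rpow_mul_rpow ht hS0 (by linarith) (by linarith) hp hp1 hθ hθ1]
        ring_nf
    _ ≤ 2 * geomInterp t S (p + θ * q / 2) := by
        gcongr
        · exact geomInterp_nonneg ht hS0
        · simpa using Real.rpow_le_rpow_of_exponent_le (by norm_num : (1 : ℝ) ≤ 2) hθ1

end Interpolation

section LogConvex

variable {a : ℕ → ℝ}

lemma pow_succ_le_mul_pow_of_sq_le (ha : ∀ n, 0 ≤ a n)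
    (h : ∀ n, a (n + 1) ^ 2 ≤ a n * a (n + 2)) (n : ℕ) :
    a n ^ (n + 1) ≤ a 0 * a (n + 1) ^ n := by
  induction n with
  | zero => simp
  | succ n ih =>
    rcases (ha (n + 1)).eq_or_lt with h0 | h0
    · rw [← h0, zero_pow (by omega)]
      exact mul_nonneg (ha 0) (pow_nonneg (ha _) _)
    · refine le_of_mul_le_mul_left ?_ (pow_pos h0 n)
      calc a (n + 1) ^ n * a (n + 1) ^ (n + 1 + 1) = (a (n + 1) ^ 2) ^ (n + 1) := by ring
        _ ≤ (a n * a (n + 2)) ^ (n + 1) := by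
          gcongr
          exact h n
        _ = a n ^ (n + 1) * a (n + 2) ^ (n + 1) := mul_pow _ _ _
        _ ≤ a 0 * a (n + 1) ^ n * a (n + 2) ^ (n + 1) := by
          gcongr
          exact pow_nonneg (ha _) _
        _ = a (n + 1) ^ n * (a 0 * a (n + 1 + 1) ^ (n + 1)) := by ring

lemma pow_add_le_pow_mul_pow_of_sq_le (ha : ∀ n, 0 ≤ a n)
    (h : ∀ n, a (n + 1) ^ 2 ≤ a n * a (n + 2)) (j m : ℕ) :
    a j ^ (j + m) ≤ a 0 ^ m * a (j + m) ^ j := by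
  induction m with
  | zero => simp
  | succ m ih =>
    rcases Nat.eq_zero_or_pos (j + m) with h0 | h0
    · obtain ⟨rfl, rfl⟩ : j = 0 ∧ m = 0 := by omega
      simp
    · have h1 := ha 0
      have h2 := ha (j + m)
      have h3 := ha (j + m + 1)
      refine le_of_pow_le_pow_left₀ h0.ne' (by rw [← add_assoc]; positivity) ?_
      calc (a j ^ (j + (m + 1))) ^ (j + m) = (a j ^ (j + m)) ^ (j + m + 1) := by ring
        _ ≤ (a 0 ^ m * a (j + m) ^ j) ^ (j + m + 1) := by
          gcongr
          exact pow_nonneg (ha _) _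
        _ = a 0 ^ (m * (j + m + 1)) * (a (j + m) ^ (j + m + 1)) ^ j := by ring
        _ ≤ a 0 ^ (m * (j + m + 1)) * (a 0 * a (j + m + 1) ^ (j + m)) ^ j := by
          gcongr
          exact pow_succ_le_mul_pow_of_sq_le ha h _
        _ = (a 0 ^ (m + 1) * a (j + (m + 1)) ^ j) ^ (j + m) := by
          rw [← add_assoc]; ring

/-- A log-convex sequence lies below its geometric interpolation. -/
lemma le_geomInterp_of_sq_le (ha : ∀ n, 0 ≤ a n)
    (h : ∀ n, a (n + 1) ^ 2 ≤ a n * a (n + 2)) {S : ℝ} {j K : ℕ} (hK : 0 < K) (hj : j ≤ K)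
    (hS : a K ≤ S) : a j ≤ geomInterp (a 0) S (j / K) := by
  obtain ⟨m, rfl⟩ := Nat.exists_eq_add_of_le hj
  have h0 := ha 0
  have hS0 := (ha _).trans hS
  have hK' : ((j + m : ℕ) : ℝ) ≠ 0 := by positivity
  refine le_of_pow_le_pow_left₀ hK.ne' (geomInterp_nonneg h0 hS0) ?_
  calc a j ^ (j + m) ≤ a 0 ^ m * a (j + m) ^ j := pow_add_le_pow_mul_pow_of_sq_le ha h j m
    _ ≤ a 0 ^ m * S ^ j := by
      gcongr
      exact ha _
    _ = geomInterp (a 0) S (j / (j + m : ℕ)) ^ (j + m) := by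
      rw [geomInterp, mul_pow, ← Real.rpow_mul_natCast h0, ← Real.rpow_mul_natCast hS0,
        div_mul_cancel₀ _ hK', sub_mul, div_mul_cancel₀ _ hK', Real.rpow_natCast, one_mul,
        show ((j + m : ℕ) : ℝ) - j = m by push_cast; ring, Real.rpow_natCast]

end LogConvex

section Integrals

variable {L : ℝ} {f g : ℝ → ℝ}

lemma integral_sq_nonneg (hL : 0 ≤ L) : 0 ≤ ∫ x in (0:ℝ)..L, f x ^ 2 :=
  intervalIntegral.integral_nonneg hL fun _ _ => sq_nonneg _

/-- The Cauchy–Schwarz inequality for interval integrals of continuous functions. -/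
lemma integral_mul_le_sqrt_mul_sqrt (hL : 0 ≤ L) (hf : Continuous f) (hg : Continuous g) :
    ∫ x in (0:ℝ)..L, f x * g x ≤
      √(∫ x in (0:ℝ)..L, f x ^ 2) * √(∫ x in (0:ℝ)..L, g x ^ 2) := by
  have hquad : ∀ t : ℝ, 0 ≤ (∫ x in (0:ℝ)..L, f x ^ 2) * (t * t) +
      (2 * ∫ x in (0:ℝ)..L, f x * g x) * t + ∫ x in (0:ℝ)..L, g x ^ 2 := by
    intro t
    have h0 := integral_sq_nonneg (f := fun x => t * f x + g x) hL
    have hexp : ∫ x in (0:ℝ)..L, (t * f x + g x) ^ 2 = (∫ x in (0:ℝ)..L, t * t * f x ^ 2) +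
        (∫ x in (0:ℝ)..L, 2 * t * (f x * g x)) + ∫ x in (0:ℝ)..L, g x ^ 2 := by
      rw [← intervalIntegral.integral_add, ← intervalIntegral.integral_add]
      · congr 1; ext x; ring
      all_goals exact Continuous.intervalIntegrable (by fun_prop) _ _
    rw [hexp, intervalIntegral.integral_const_mul, intervalIntegral.integral_const_mul] at h0
    linarith
  have hd := discrim_le_zero hquad
  unfold discrim at hd
  rw [← Real.sqrt_mul (integral_sq_nonneg hL)]
  apply Real.le_sqrt_of_sq_le
  linarith

/-- Integration by parts for periodic functions, combined with Cauchy–Schwarz. -/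
lemma integral_deriv_sq_le {f' f'' : ℝ → ℝ} (hL : 0 ≤ L) (hf : ∀ x, HasDerivAt f (f' x) x)
    (hf' : ∀ x, HasDerivAt f' (f'' x) x) (hc : Continuous f'') (hper : f L = f 0)
    (hper' : f' L = f' 0) :
    ∫ x in (0:ℝ)..L, f' x ^ 2 ≤
      √(∫ x in (0:ℝ)..L, f x ^ 2) * √(∫ x in (0:ℝ)..L, f'' x ^ 2) := by
  have hcf : Continuous f := continuous_iff_continuousAt.2 fun x => (hf x).continuousAt
  have hcf' : Continuous f' := continuous_iff_continuousAt.2 fun x => (hf' x).continuousAt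
  have hparts := intervalIntegral.integral_mul_deriv_eq_deriv_mul
    (fun x _ => hf x) (fun x _ => hf' x) (hcf'.intervalIntegrable 0 L) (hc.intervalIntegrable 0 L)
  have hcs := integral_mul_le_sqrt_mul_sqrt (f := fun x => -f x) hL hcf.neg hc
  simp only [neg_mul, neg_sq, intervalIntegral.integral_neg] at hcs
  rw [hper, hper', sub_self, zero_sub] at hparts
  have hsq : ∫ x in (0:ℝ)..L, f' x ^ 2 = ∫ x in (0:ℝ)..L, f' x * f' x := by simp only [sq]
  linarith

/-- The one-dimensional Sobolev bound `L f(x)² ≤ ∫ f² + 2L ‖f‖₂ ‖f'‖₂`. -/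
lemma mul_sq_le_integral_sq_add {f' : ℝ → ℝ} (hL : 0 ≤ L) (hf : ∀ x, HasDerivAt f (f' x) x)
    (hc : Continuous f') {x : ℝ} (hx : x ∈ Set.Icc 0 L) :
    L * f x ^ 2 ≤ (∫ y in (0:ℝ)..L, f y ^ 2) +
      2 * L * (√(∫ y in (0:ℝ)..L, f y ^ 2) * √(∫ y in (0:ℝ)..L, f' y ^ 2)) := by
  have hcf : Continuous f := continuous_iff_continuousAt.2 fun x => (hf x).continuousAt
  have hcs := integral_mul_le_sqrt_mul_sqrt hL hcf.abs hc.abs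
  simp only [sq_abs] at hcs
  set C := √(∫ y in (0:ℝ)..L, f y ^ 2) * √(∫ y in (0:ℝ)..L, f' y ^ 2)
  have hpt : ∀ y ∈ Set.Icc 0 L, f x ^ 2 ≤ f y ^ 2 + 2 * C := by
    intro y hy
    have hftc : ∫ z in y..x, 2 * (f z * f' z) = f x ^ 2 - f y ^ 2 := by
      refine intervalIntegral.integral_eq_sub_of_hasDerivAt (f := fun z => f z ^ 2) (fun z _ => ?_)
        (Continuous.intervalIntegrable (by fun_prop) _ _)
      simpa [mul_assoc] using (hf z).fun_pow 2
    have habs : |∫ z in y..x, f z * f' z| ≤ ∫ z in (0:ℝ)..L, |f z| * |f' z| := by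
      simp only [← abs_mul]
      rw [intervalIntegral.integral_of_le hL, ← Set.uIoc_of_le hL]
      refine (intervalIntegral.norm_integral_le_integral_norm_uIoc (f := fun z => f z * f' z)).trans ?_
      refine setIntegral_mono_set ?_ (.of_forall fun _ => norm_nonneg _) (Set.Ioc_subset_Ioc
        (le_min (by simp [hy.1]) (by simp [hx.1])) ?_).eventuallyLE
      · exact (Continuous.intervalIntegrable (by fun_prop) _ _).def'
      · simpa [hL] using And.intro hy.2 hx.2
    rw [intervalIntegral.integral_const_mul] at hftc
    linarith [le_abs_self (∫ z in y..x, f z * f' z)]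
  have hcont : Continuous fun y => f y ^ 2 := by fun_prop
  calc L * f x ^ 2 = ∫ _ in (0:ℝ)..L, f x ^ 2 := by simp
    _ ≤ ∫ y in (0:ℝ)..L, (f y ^ 2 + 2 * C) :=
        intervalIntegral.integral_mono_on hL (continuous_const.intervalIntegrable _ _)
          ((hcont.add continuous_const).intervalIntegrable _ _) hpt
    _ = (∫ y in (0:ℝ)..L, f y ^ 2) + 2 * L * C := by
        rw [intervalIntegral.integral_add (hcont.intervalIntegrable _ _)
          (continuous_const.intervalIntegrable _ _)]
        simp only [intervalIntegral.integral_const, sub_zero, smul_eq_mul]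
        ring

/-- Interpolation of the `Lˡ` norm between `L²` and a pointwise bound. -/
lemma integral_abs_rpow_le {M l : ℝ} (hL : 0 ≤ L) (hl : 2 ≤ l) (hf : Continuous f)
    (hM : ∀ x ∈ Set.Icc 0 L, |f x| ≤ M) :
    ∫ x in (0:ℝ)..L, |f x| ^ l ≤ M ^ (l - 2) * ∫ x in (0:ℝ)..L, f x ^ 2 := by
  rw [← intervalIntegral.integral_const_mul]
  refine intervalIntegral.integral_mono_on hL
    ((hf.abs.rpow_const fun _ => Or.inr (by linarith)).intervalIntegrable _ _)
    (Continuous.intervalIntegrable (by fun_prop) _ _) fun x hx => ?_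
  calc |f x| ^ l = |f x| ^ (l - 2) * |f x| ^ (2 : ℝ) := by
        rw [← Real.rpow_add_of_nonneg (abs_nonneg _) (by linarith) (by norm_num)]; ring_nf
    _ = |f x| ^ (l - 2) * f x ^ 2 := by rw [Real.rpow_two, sq_abs]
    _ ≤ M ^ (l - 2) * f x ^ 2 := by
        gcongr
        exact hM x hx

end Integrals

section Derivatives

variable {L : ℝ} {φ : ℝ → ℝ}

lemma ContDiff.hasDerivAt_iteratedDeriv (hφ : ContDiff ℝ (⊤ : ℕ∞) φ) (j : ℕ) (x : ℝ) :
    HasDerivAt (iteratedDeriv j φ) (iteratedDeriv (j + 1) φ x) x := by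
  rw [iteratedDeriv_succ]
  exact (hφ.differentiable_iteratedDeriv j (by exact_mod_cast WithTop.coe_lt_top j) x).hasDerivAt

lemma ContDiff.continuous_iteratedDeriv_of_top (hφ : ContDiff ℝ (⊤ : ℕ∞) φ) (j : ℕ) :
    Continuous (iteratedDeriv j φ) :=
  hφ.continuous_iteratedDeriv j (by exact_mod_cast le_top)

lemma Function.Periodic.iteratedDeriv (hφ : Function.Periodic φ L) (j : ℕ) :
    Function.Periodic (iteratedDeriv j φ) L := by
  intro x
  rw [← congrFun (iteratedDeriv_comp_add_const j φ L) x, funext hφ]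

lemma scaledDerivNorm_nonneg (hL : 0 < L) (j : ℕ) : 0 ≤ scaledDerivNorm L φ j := by
  unfold scaledDerivNorm
  positivity

lemma scaledDerivNorm_sq (hL : 0 < L) (j : ℕ) :
    scaledDerivNorm L φ j ^ 2 =
      L ^ (2 * (j : ℝ) + 1) * ∫ x in (0:ℝ)..L, (iteratedDeriv j φ x) ^ 2 := by
  rw [scaledDerivNorm, mul_pow, Real.sq_sqrt (integral_sq_nonneg hL.le),
    ← Real.rpow_mul_natCast hL.le]
  push_cast
  ring_nf

lemma scaledDerivNorm_mul (hL : 0 < L) (j k : ℕ) :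
    scaledDerivNorm L φ j * scaledDerivNorm L φ k =
      L ^ ((j : ℝ) + k + 1) * (√(∫ x in (0:ℝ)..L, (iteratedDeriv j φ x) ^ 2) *
        √(∫ x in (0:ℝ)..L, (iteratedDeriv k φ x) ^ 2)) := by
  rw [scaledDerivNorm, scaledDerivNorm, mul_mul_mul_comm, ← Real.rpow_add hL]
  ring_nf

lemma scaledDerivNorm_sq_le (hφ : ContDiff ℝ (⊤ : ℕ∞) φ) (hper : Function.Periodic φ L)
    (hL : 0 < L) (j : ℕ) :
    scaledDerivNorm L φ (j + 1) ^ 2 ≤ scaledDerivNorm L φ j * scaledDerivNorm L φ (j + 2) := by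
  rw [scaledDerivNorm_sq hL, scaledDerivNorm_mul hL,
    show (j : ℝ) + (j + 2 : ℕ) + 1 = 2 * ((j + 1 : ℕ) : ℝ) + 1 by push_cast; ring]
  gcongr
  exact integral_deriv_sq_le hL.le (hφ.hasDerivAt_iteratedDeriv j)
    (hφ.hasDerivAt_iteratedDeriv (j + 1)) (hφ.continuous_iteratedDeriv_of_top _)
    (hper.iteratedDeriv j).eq (hper.iteratedDeriv (j + 1)).eq

lemma sobNorm_eq_sum (K : ℕ) (L : ℝ) (φ : ℝ → ℝ) :
    sobNorm K L φ = ∑ j ∈ Finset.range (K + 1), scaledDerivNorm L φ j := by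
  simp only [sobNorm, scaledDerivNorm, Real.sqrt_eq_rpow]

lemma scaledDerivNorm_le_sobNorm (hL : 0 < L) {j K : ℕ} (hj : j ≤ K) :
    scaledDerivNorm L φ j ≤ sobNorm K L φ := by
  rw [sobNorm_eq_sum]
  exact Finset.single_le_sum (fun i _ => scaledDerivNorm_nonneg hL i)
    (Finset.mem_range.2 (Nat.lt_succ_of_le hj))

/-- Scale-invariant pointwise bound for the `i`-th derivative. -/
lemma rpow_mul_abs_iteratedDeriv_le (hφ : ContDiff ℝ (⊤ : ℕ∞) φ) (hL : 0 < L) (i : ℕ) {x : ℝ}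
    (hx : x ∈ Set.Icc 0 L) :
    L ^ ((i : ℝ) + 1) * |iteratedDeriv i φ x| ≤
      √(scaledDerivNorm L φ i ^ 2 + 2 * (scaledDerivNorm L φ i * scaledDerivNorm L φ (i + 1))) := by
  apply Real.le_sqrt_of_sq_le
  have h := mul_le_mul_of_nonneg_left (mul_sq_le_integral_sq_add hL.le
    (hφ.hasDerivAt_iteratedDeriv i) (hφ.continuous_iteratedDeriv_of_top (i + 1)) hx)
    (Real.rpow_nonneg hL.le (2 * (i : ℝ) + 1))
  have hpow : L ^ (2 * (i : ℝ) + 1) * L = L ^ ((i : ℝ) + (i + 1 : ℕ) + 1) := by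
    rw [← Real.rpow_add_one hL.ne']; push_cast; ring_nf
  have hpow' : (L ^ ((i : ℝ) + 1)) ^ 2 = L ^ ((i : ℝ) + (i + 1 : ℕ) + 1) := by
    rw [← Real.rpow_mul_natCast hL.le]; push_cast; ring_nf
  rw [scaledDerivNorm_sq hL, scaledDerivNorm_mul hL, mul_pow, sq_abs, hpow', ← hpow]
  linarith

/-- The scale-invariant `Lˡ` norm is interpolated between the `L²` norm and a pointwise bound. -/
lemma rpow_mul_integral_rpow_le {l M : ℝ} (hφ : ContDiff ℝ (⊤ : ℕ∞) φ) (hL : 0 < L) (hl : 2 ≤ l)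
    (i : ℕ) (hM : 0 ≤ M) (hsup : ∀ x ∈ Set.Icc 0 L, L ^ ((i : ℝ) + 1) * |iteratedDeriv i φ x| ≤ M) :
    L ^ ((i : ℝ) + 1 - 1 / l) * (∫ x in (0:ℝ)..L, |iteratedDeriv i φ x| ^ l) ^ (1 / l) ≤
      M ^ (1 - 2 / l) * scaledDerivNorm L φ i ^ (2 / l) := by
  have hl0 : 0 < l := by linarith
  have hA : 0 ≤ ∫ x in (0:ℝ)..L, (iteratedDeriv i φ x) ^ 2 := integral_sq_nonneg hL.le
  set A := ∫ x in (0:ℝ)..L, (iteratedDeriv i φ x) ^ 2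
  have hLi : 0 < L ^ ((i : ℝ) + 1) := Real.rpow_pos_of_pos hL _
  have hbound := integral_abs_rpow_le hL.le hl (hφ.continuous_iteratedDeriv_of_top i)
    (M := M / L ^ ((i : ℝ) + 1)) fun x hx => by
      rw [le_div_iff₀ hLi, mul_comm]; exact hsup x hx
  have hexp : (l - 2) * (1 / l) = 1 - 2 / l := by field_simp
  calc L ^ ((i : ℝ) + 1 - 1 / l) * (∫ x in (0:ℝ)..L, |iteratedDeriv i φ x| ^ l) ^ (1 / l)
      ≤ L ^ ((i : ℝ) + 1 - 1 / l) * ((M / L ^ ((i : ℝ) + 1)) ^ (l - 2) * A) ^ (1 / l) := by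
        gcongr
        exact intervalIntegral.integral_nonneg hL.le fun x _ => by positivity
    _ = L ^ ((i : ℝ) + 1 - 1 / l) * (M ^ (1 - 2 / l) / L ^ (((i : ℝ) + 1) * (1 - 2 / l)) *
          A ^ (1 / l)) := by
        rw [Real.mul_rpow (by positivity) hA, ← Real.rpow_mul (by positivity), hexp,
          Real.div_rpow hM hLi.le, ← Real.rpow_mul hL.le]
    _ = M ^ (1 - 2 / l) * (L ^ (((i : ℝ) + 1 / 2) * (2 / l)) * A ^ (1 / l)) := by
        rw [show (i : ℝ) + 1 - 1 / l = ((i : ℝ) + 1) * (1 - 2 / l) + ((i : ℝ) + 1 / 2) * (2 / l) by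
          field_simp; ring, Real.rpow_add hL]
        field_simp
    _ = M ^ (1 - 2 / l) * scaledDerivNorm L φ i ^ (2 / l) := by
        rw [scaledDerivNorm, Real.mul_rpow (by positivity) (Real.sqrt_nonneg _),
          ← Real.rpow_mul hL.le, Real.sqrt_eq_rpow, ← Real.rpow_mul hA]
        ring_nf

end Derivatives

/-- **Gagliardo–Nirenberg-type interpolation inequality of
Dziuk–Kuwert–Schätzle** (Appendix Lemma A.3). For every `K ≥ 1` there is
`c = c(K) > 0` such that for every smooth `L`-periodic `φ`, every real `l ≥ 2`
and every `0 ≤ i < K`, with `α = (i + 1/2 − 1/l)/K`: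
`L^{i+1−1/l} (∫₀^L |φ^{(i)}|^l)^{1/l} ≤ c (L ∫₀^L φ²)^{(1−α)/2} ‖φ‖_{K,2}^α`. -/
theorem dks_interpolation :
    ∀ K : ℕ, 1 ≤ K → ∃ c : ℝ, 0 < c ∧
      ∀ (φ : ℝ → ℝ) (L l : ℝ) (i : ℕ),
        ContDiff ℝ (⊤ : ℕ∞) φ → Function.Periodic φ L → 0 < L → 2 ≤ l → i < K →
        L ^ ((i : ℝ) + 1 - 1 / l) *
            (∫ x in (0:ℝ)..L, |iteratedDeriv i φ x| ^ l) ^ (1 / l) ≤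
          c * (L * ∫ x in (0:ℝ)..L, (φ x) ^ 2) ^
              ((1 - ((i : ℝ) + 1 / 2 - 1 / l) / K) / 2) *
            sobNorm K L φ ^ (((i : ℝ) + 1 / 2 - 1 / l) / K) := by
  intro K hK
  refine ⟨2, two_pos, fun φ L l i hφ hper hL hl hi => ?_⟩
  have hl0 : 0 < l := by linarith
  have hK0 : (0 : ℝ) < K := by exact_mod_cast hK
  have hθ : 2 / l ≤ 1 := (div_le_one hl0).2 hl
  have hθ0 : 0 < 2 / l := by positivity
  have hnonneg := scaledDerivNorm_nonneg (φ := φ) hL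
  have hinterp : ∀ j ≤ K, scaledDerivNorm L φ j ≤
      geomInterp (scaledDerivNorm L φ 0) (sobNorm K L φ) (j / K) := fun j hj =>
    le_geomInterp_of_sq_le hnonneg (scaledDerivNorm_sq_le hφ hper hL) hK hj
      (scaledDerivNorm_le_sobNorm hL le_rfl)
  have hsucc := hinterp (i + 1) hi
  rw [show ((i + 1 : ℕ) : ℝ) / K = i / K + 1 / K by push_cast; ring] at hsucc
  have hmain := rpow_mul_rpow_le_geomInterp (θ := 1 - 2 / l) (hnonneg 0)
    (scaledDerivNorm_le_sobNorm hL K.zero_le) (by positivity) (by positivity)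
    (by rw [← add_div, div_le_one hK0]; exact_mod_cast hi) (by linarith) (by linarith)
    (hnonneg i) (Real.sqrt_nonneg _) (hinterp i hi.le) hsucc
    (Real.sq_sqrt (add_nonneg (sq_nonneg _)
      (mul_nonneg two_pos.le (mul_nonneg (hnonneg i) (hnonneg (i + 1)))))).le
  rw [sub_sub_cancel, show (i : ℝ) / K + (1 - 2 / l) * (1 / K) / 2 = (i + 1 / 2 - 1 / l) / K by
    field_simp; ring] at hmain
  refine (rpow_mul_integral_rpow_le hφ hL hl i (Real.sqrt_nonneg _) fun x hx =>
    rpow_mul_abs_iteratedDeriv_le hφ hL i hx).trans (hmain.trans_eq ?_)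
  have hzero : L * ∫ x in (0:ℝ)..L, φ x ^ 2 = scaledDerivNorm L φ 0 ^ (2 : ℝ) := by
    rw [Real.rpow_two, scaledDerivNorm_sq hL]
    simp
  rw [hzero, ← Real.rpow_mul (hnonneg 0), mul_div_cancel₀ _ two_ne_zero, geomInterp, mul_assoc]
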